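/- arXiv:2301.06220 — 2 statements merged into one kernel-verified Lean document; each statement's English description precedes it below -/
import Mathlib

section
/- Let X be a quasiregular Hausdorff topological space. Then |X| ≤ 2^{c(X)^{πχ(X)}} (iterated cardinal exponentiation). -/
open Set TopologicalSpace Cardinal

universe u

variable (X : Type u) [TopologicalSpace X]

/-- The density `d(X)`: the least infinite cardinal `κ` such that `X` has a dense
subset of cardinality at most `κ`. -/
noncomputable def density : Cardinal.{u} :=
  sInf {κ : Cardinal.{u} | ℵ₀ ≤ κ ∧ ∃ D : Set X, Dense D ∧ #D ≤ κ}

/-- The cellularity `c(X)`: the least infinite cardinal `κ` such that every pairwise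
disjoint family of nonempty open subsets of `X` has cardinality at most `κ`. -/
noncomputable def cellularity : Cardinal.{u} :=
  sInf {κ : Cardinal.{u} | ℵ₀ ≤ κ ∧ ∀ 𝒰 : Set (Set X),
    (∀ U ∈ 𝒰, IsOpen U ∧ U.Nonempty) → (𝒰.Pairwise fun U V => U ∩ V = ∅) → #𝒰 ≤ κ}

/-- The π-character of a point `x`: the least infinite cardinal `κ` such that `x`
has a local π-base of cardinality at most `κ`. -/
noncomputable def piCharAt (x : X) : Cardinal.{u} :=
  sInf {κ : Cardinal.{u} | ℵ₀ ≤ κ ∧ ∃ ℬ : Set (Set X),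
    (∀ B ∈ ℬ, IsOpen B ∧ B.Nonempty) ∧
    (∀ U : Set X, IsOpen U → x ∈ U → ∃ B ∈ ℬ, B ⊆ U) ∧ #ℬ ≤ κ}

/-- The π-character `πχ(X)`: the supremum over `x ∈ X` of `piCharAt X x`. -/
noncomputable def piChar : Cardinal.{u} := ⨆ x : X, piCharAt X x

/-- The π-weight `πw(X)`: the least infinite cardinal `κ` such that `X` has a π-base
of cardinality at most `κ`. -/
noncomputable def piWeight : Cardinal.{u} :=
  sInf {κ : Cardinal.{u} | ℵ₀ ≤ κ ∧ ∃ ℬ : Set (Set X),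
    (∀ B ∈ ℬ, IsOpen B ∧ B.Nonempty) ∧
    (∀ U : Set X, IsOpen U → U.Nonempty → ∃ B ∈ ℬ, B ⊆ U) ∧ #ℬ ≤ κ}

/-- The closed pseudocharacter `ψc(x, X)` of a point `x`: the least infinite cardinal
`κ` such that there is a family `𝒱` of open sets, each containing `x`, with `|𝒱| ≤ κ`
and `{x} = ⋂ 𝒱 = ⋂_{V ∈ 𝒱} cl V`. -/
noncomputable def closedPseudoCharAt (x : X) : Cardinal.{u} :=
  sInf {κ : Cardinal.{u} | ℵ₀ ≤ κ ∧ ∃ 𝒱 : Set (Set X),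
    (∀ V ∈ 𝒱, IsOpen V ∧ x ∈ V) ∧ #𝒱 ≤ κ ∧
    ({x} : Set X) = ⋂₀ 𝒱 ∧ ({x} : Set X) = ⋂ V ∈ 𝒱, closure V}

/-- The dense closed pseudocharacter `dψc(X)`: the least infinite cardinal `κ` such
that `X` has a dense subset `D` with `ψc(d, X) ≤ κ` for every `d ∈ D`. -/
noncomputable def densePsiC : Cardinal.{u} :=
  sInf {κ : Cardinal.{u} | ℵ₀ ≤ κ ∧ ∃ D : Set X, Dense D ∧
    ∀ d ∈ D, closedPseudoCharAt X d ≤ κ}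

/-- The weak closed pseudocharacter of a point `x`: the least infinite cardinal `κ`
such that there is a family `𝒱` of open sets (not necessarily containing `x`) with
`|𝒱| ≤ κ` and `{x} = ⋂_{V ∈ 𝒱} cl V`. -/
noncomputable def weakPsiCAt (x : X) : Cardinal.{u} :=
  sInf {κ : Cardinal.{u} | ℵ₀ ≤ κ ∧ ∃ 𝒱 : Set (Set X),
    (∀ V ∈ 𝒱, IsOpen V) ∧ (({x} : Set X) = ⋂ V ∈ 𝒱, closure V) ∧ #𝒱 ≤ κ}

/-- The weak closed pseudocharacter `wψc(X)`: the supremum over `x ∈ X`. -/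
noncomputable def weakPsiC : Cardinal.{u} := ⨆ x : X, weakPsiCAt X x

/-- The q-pseudocharacter of a point `x`: the least infinite cardinal `κ` such that
`x` has a q-pseudobase of cardinality at most `κ`, i.e. a family `ℬ` of nonempty open
sets such that for every `y ≠ x` there is `𝒞 ⊆ ℬ` with `x ∈ cl (⋃ 𝒞)` and
`y ∉ cl (⋃ 𝒞)`. -/
noncomputable def qPsiAt (x : X) : Cardinal.{u} :=
  sInf {κ : Cardinal.{u} | ℵ₀ ≤ κ ∧ ∃ ℬ : Set (Set X),
    (∀ B ∈ ℬ, IsOpen B ∧ B.Nonempty) ∧ #ℬ ≤ κ ∧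
    ∀ y : X, y ≠ x → ∃ 𝒞 ⊆ ℬ, x ∈ closure (⋃₀ 𝒞) ∧ y ∉ closure (⋃₀ 𝒞)}

/-- The q-pseudocharacter `qψ(X)`: the supremum over `x ∈ X`. -/
noncomputable def qPsi : Cardinal.{u} := ⨆ x : X, qPsiAt X x

/-- The o-tightness `ot(X)`: the least infinite cardinal `κ` such that whenever
`x ∈ cl (⋃ 𝒰)` for a family `𝒰` of open sets, there is `𝒱 ⊆ 𝒰` with `|𝒱| ≤ κ`
and `x ∈ cl (⋃ 𝒱)`. -/
noncomputable def oTightness : Cardinal.{u} :=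
  sInf {κ : Cardinal.{u} | ℵ₀ ≤ κ ∧ ∀ (x : X) (𝒰 : Set (Set X)),
    (∀ U ∈ 𝒰, IsOpen U) → x ∈ closure (⋃₀ 𝒰) →
    ∃ 𝒱 ⊆ 𝒰, #𝒱 ≤ κ ∧ x ∈ closure (⋃₀ 𝒱)}

/-- The dense o-tightness `dot(X)`: the least infinite cardinal `κ` such that whenever
`𝒰` is a family of open sets with `⋃ 𝒰` dense in `X` and `x ∈ X`, there is `𝒱 ⊆ 𝒰`
with `|𝒱| ≤ κ` and `x ∈ cl (⋃ 𝒱)`. -/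
noncomputable def denseOTightness : Cardinal.{u} :=
  sInf {κ : Cardinal.{u} | ℵ₀ ≤ κ ∧ ∀ (x : X) (𝒰 : Set (Set X)),
    (∀ U ∈ 𝒰, IsOpen U) → Dense (⋃₀ 𝒰) →
    ∃ 𝒱 ⊆ 𝒰, #𝒱 ≤ κ ∧ x ∈ closure (⋃₀ 𝒱)}

/-- A space is quasiregular if every nonempty open set contains the closure of some
nonempty open set. -/
def QuasiRegular : Prop :=
  ∀ U : Set X, IsOpen U → U.Nonempty → ∃ V : Set X, IsOpen V ∧ V.Nonempty ∧ closure V ⊆ U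

/-- The collection `RO(X)` of regular open subsets of `X`. -/
def regularOpens : Set (Set X) := {U : Set X | U = interior (closure U)}

theorem aux_cell_spec (X : Type u) [TopologicalSpace X] : ℵ₀ ≤ cellularity X ∧
    ∀ 𝒰 : Set (Set X), (∀ U ∈ 𝒰, IsOpen U ∧ U.Nonempty) →
      (𝒰.Pairwise fun U V => U ∩ V = ∅) → #𝒰 ≤ cellularity X := by
  refine csInf_mem (s := {κ : Cardinal.{u} | ℵ₀ ≤ κ ∧ ∀ 𝒰 : Set (Set X),
    (∀ U ∈ 𝒰, IsOpen U ∧ U.Nonempty) → (𝒰.Pairwise fun U V => U ∩ V = ∅) → #𝒰 ≤ κ}) ?_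
  exact ⟨max ℵ₀ #(Set X), le_max_left _ _, fun 𝒰 _ _ => (mk_set_le 𝒰).trans (le_max_right _ _)⟩

theorem aux_pi_spec (X : Type u) [TopologicalSpace X] (x : X) : ℵ₀ ≤ piChar X ∧
    ∃ ℬ : Set (Set X), (∀ B ∈ ℬ, IsOpen B ∧ B.Nonempty) ∧
    (∀ U : Set X, IsOpen U → x ∈ U → ∃ B ∈ ℬ, B ⊆ U) ∧ #ℬ ≤ piChar X := by
  have h := csInf_mem (s := {κ : Cardinal.{u} | ℵ₀ ≤ κ ∧ ∃ ℬ : Set (Set X),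
    (∀ B ∈ ℬ, IsOpen B ∧ B.Nonempty) ∧
    (∀ U : Set X, IsOpen U → x ∈ U → ∃ B ∈ ℬ, B ⊆ U) ∧ #ℬ ≤ κ})
    ⟨max ℵ₀ #(Set X), le_max_left _ _, {B | IsOpen B ∧ B.Nonempty}, fun B hB => hB,
      fun U hU hx => ⟨U, ⟨hU, ⟨x, hx⟩⟩, subset_rfl⟩, (mk_set_le _).trans (le_max_right _ _)⟩
  have h2 : piCharAt X x ≤ piChar X :=
    le_ciSup (f := fun x : X => piCharAt X x) (bddAbove_of_small) x
  obtain ⟨h0, ℬ, h3, h4, h5⟩ := h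
  exact ⟨le_trans h0 h2, ℬ, h3, h4, le_trans h5 h2⟩

theorem aux_cell_dense (X : Type u) [TopologicalSpace X] (W : Set (Set X))
    (hW : ∀ U ∈ W, IsOpen U) :
    ∃ U ⊆ W, #U ≤ cellularity X ∧ ⋃₀ W ⊆ closure (⋃₀ U) := by
  obtain ⟨D, hD⟩ := zorn_subset {D : Set (Set X) |
      (∀ U ∈ D, (IsOpen U ∧ U.Nonempty) ∧ ∃ G ∈ W, U ⊆ G) ∧
      (D.Pairwise fun U V => U ∩ V = ∅)} (by
    intro c hc hch
    refine ⟨⋃₀ c, ⟨?_, ?_⟩, fun s hs => subset_sUnion_of_mem hs⟩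
    · rintro U ⟨s, hs, hU⟩
      exact (hc hs).1 U hU
    · exact (pairwise_sUnion hch.directedOn).2 fun s hs => (hc hs).2)
  have hD1 := hD.prop.1
  choose! g hgW hg using fun U hU => (hD1 U hU).2
  refine ⟨g '' D, ?_, ?_, ?_⟩
  · rintro _ ⟨U, hU, rfl⟩
    exact hgW U hU
  · exact mk_image_le.trans ((aux_cell_spec X).2 D (fun U hU => (hD1 U hU).1) hD.prop.2)
  · rintro p ⟨G, hG, hp⟩
    by_contra hcl
    set E := G ∩ (closure (⋃₀ (g '' D)))ᶜ with hE
    have hdis : ∀ U ∈ D, E ∩ U = ∅ := by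
      intro U hU
      rw [eq_empty_iff_forall_notMem]
      rintro y ⟨⟨_, hy⟩, hyU⟩
      exact hy (subset_closure ⟨g U, ⟨U, hU, rfl⟩, hg U hU hyU⟩)
    have hne : E.Nonempty := ⟨p, hp, hcl⟩
    have hmem : insert E D ∈ {D : Set (Set X) |
      (∀ U ∈ D, (IsOpen U ∧ U.Nonempty) ∧ ∃ G ∈ W, U ⊆ G) ∧
      (D.Pairwise fun U V => U ∩ V = ∅)} := by
      refine ⟨?_, ?_⟩
      · rintro U (rfl | hU)
        · exact ⟨⟨(hW G hG).inter isClosed_closure.isOpen_compl, hne⟩, G, hG, inter_subset_left⟩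
        · exact hD1 U hU
      · refine hD.prop.2.insert ?_
        intro U hU _
        exact ⟨hdis U hU, by rw [inter_comm]; exact hdis U hU⟩
    have : E ∈ D := hD.le_of_ge hmem (subset_insert _ _) (mem_insert _ _)
    have h1 := hdis E this
    rw [inter_self] at h1
    exact hne.ne_empty h1

/-- Arity for the W-type of points. -/
def auxAr (K L : Type u) : Option (L → K) → Type u
  | none => PEmpty
  | some _ => L

/-- Evaluation of W-type terms as points. -/
noncomputable def auxEv {X K L : Type u} (x0 : X) (b : X → K → Set X)
    (op : (L → Set X) → X) : WType (auxAr K L) → X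
  | WType.mk none _ => x0
  | WType.mk (some j) f => op (fun i : L => b (auxEv x0 b op (f i)) (j i))

theorem aux_dense (X : Type u) [TopologicalSpace X] (hqr : QuasiRegular X)
    (K L : Type u) (hL : #L = cellularity X) (x0 : X) (b : X → K → Set X)
    (hbo : ∀ x k, IsOpen (b x k) ∧ (b x k).Nonempty)
    (hb : ∀ x U, IsOpen U → x ∈ U → ∃ k, b x k ⊆ U)
    (op : (L → Set X) → X)
    (hop : ∀ s : L → Set X, (closure (⋃ i, s i))ᶜ.Nonempty → op s ∈ (closure (⋃ i, s i))ᶜ) :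
    Dense (range (auxEv x0 b op)) := by
  by_contra hnd
  set A := range (auxEv x0 b op) with hA
  have hne : (closure A)ᶜ.Nonempty := by
    rw [nonempty_compl]
    intro h
    exact hnd (dense_iff_closure_eq.2 h)
  obtain ⟨V, hVo, hVne, hV⟩ := hqr _ isClosed_closure.isOpen_compl hne
  set W : Set (Set X) := {B | (∃ a ∈ A, ∃ k, B = b a k) ∧ B ∩ V = ∅} with hWdef
  obtain ⟨U, hUW, hUc, hU⟩ := aux_cell_dense X W (by
    rintro B ⟨⟨a, _, k, rfl⟩, _⟩
    exact (hbo a k).1)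
  have hAU : A ⊆ closure (⋃₀ U) := by
    have h1 : A ⊆ closure (⋃₀ W) := by
      intro a ha
      rw [mem_closure_iff]
      intro O hO haO
      have haV : a ∈ (closure V)ᶜ := fun h => hV h (subset_closure ha)
      obtain ⟨k, hk⟩ := hb a (O ∩ (closure V)ᶜ) (hO.inter isClosed_closure.isOpen_compl) ⟨haO, haV⟩
      obtain ⟨y, hy⟩ := (hbo a k).2
      refine ⟨y, (hk hy).1, b a k, ⟨⟨a, ha, k, rfl⟩, ?_⟩, hy⟩
      rw [eq_empty_iff_forall_notMem]
      rintro z ⟨hz, hzV⟩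
      exact (hk hz).2 (subset_closure hzV)
    exact h1.trans (closure_minimal hU isClosed_closure)
  have hx0 : x0 ∈ A := ⟨WType.mk none PEmpty.elim, by simp [auxEv]⟩
  have hUne : U.Nonempty := by
    by_contra h
    rw [not_nonempty_iff_eq_empty] at h
    have := hAU hx0
    simp [h] at this
  have : Nonempty U := hUne.to_subtype
  rw [← hL] at hUc
  obtain ⟨e⟩ := hUc
  have hs : Function.Surjective (Function.invFun e) := Function.invFun_surjective e.injective
  set s := Function.invFun e
  have hsW : ∀ i : L, ∃ w k, (s i : Set X) = b (auxEv x0 b op w) k := by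
    intro i
    obtain ⟨⟨a, ⟨w, rfl⟩, k, h⟩, _⟩ := hUW (s i).2
    exact ⟨w, k, h⟩
  choose w j hwj using hsW
  have hun : (⋃ i, (s i : Set X)) = ⋃₀ U := by
    rw [sUnion_eq_iUnion]
    exact hs.iUnion_comp (fun u : U => (u : Set X))
  have hmem : op (fun i => (s i : Set X)) ∈ A := by
    refine ⟨WType.mk (some j) w, ?_⟩
    simp only [auxEv]
    congr 1
    funext i
    exact (hwj i).symm
  have hcn : (closure (⋃ i, (s i : Set X)))ᶜ.Nonempty := by
    rw [hun]
    obtain ⟨v, hv⟩ := hVne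
    refine ⟨v, fun h => ?_⟩
    obtain ⟨z, hzV, B, hB, hzB⟩ := mem_closure_iff.1 h V hVo hv
    have := (hUW hB).2
    exact (this ▸ (⟨hzB, hzV⟩ : z ∈ B ∩ V) : z ∈ (∅ : Set X))
  have := hop _ hcn
  rw [hun] at this
  exact this (hAU hmem)

theorem aux_card (K L : Type u) (hK : ℵ₀ ≤ #K) (hL : ℵ₀ ≤ #L) :
    #(WType (auxAr K L)) ≤ 2 ^ (#L ^ #K) := by
  have hL1 : #L ≤ #L ^ #K := self_le_power _ (one_le_aleph0.trans hK)
  have hK1 : #K ≤ #L ^ #K := (cantor _).le.trans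
    (power_le_power_right ((natCast_le_aleph0 (n := 2)).trans hL))
  have hM : ℵ₀ ≤ #L ^ #K := hL.trans hL1
  have hM2 : ℵ₀ ≤ (2 : Cardinal.{u}) ^ (#L ^ #K) := hM.trans (cantor _).le
  have hα : #(Option (L → K)) ≤ 2 ^ (#L ^ #K) := by
    rw [mk_option]
    refine add_le_of_le hM2 ?_ (one_le_aleph0.trans hM2)
    rw [← power_def]
    calc #K ^ #L ≤ (2 ^ #K) ^ #L := power_le_power_right (cantor _).le
      _ = 2 ^ (#K * #L) := by rw [power_mul]
      _ ≤ _ := power_le_power_left two_ne_zero (mul_le_of_le hM hK1 hL1)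
  refine WType.cardinalMk_le_of_le ?_
  refine (sum_le_mk_mul_iSup _).trans ?_
  refine mul_le_of_le hM2 hα (ciSup_le' ?_)
  rintro (_ | j)
  · change ((2 : Cardinal.{u}) ^ (#L ^ #K)) ^ #PEmpty.{u+1} ≤ _
    simpa using one_le_aleph0.trans hM2
  · change ((2 : Cardinal.{u}) ^ (#L ^ #K)) ^ #L ≤ _
    rw [← power_mul]
    exact power_le_power_left two_ne_zero (mul_le_of_le hM le_rfl hL1)

theorem stmt_13 (X : Type u) [TopologicalSpace X] [T2Space X] (hqr : QuasiRegular X) :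
    #X ≤ 2 ^ (cellularity X ^ piChar X) := by
  rcases isEmpty_or_nonempty X with hX | ⟨⟨x0⟩⟩
  · simp
  obtain ⟨K, hKc⟩ : ∃ K : Type u, #K = piChar X := ⟨_, mk_out _⟩
  obtain ⟨L, hLc⟩ : ∃ L : Type u, #L = cellularity X := ⟨_, mk_out _⟩
  have hK : ℵ₀ ≤ #K := hKc ▸ (aux_pi_spec X x0).1
  have hL : ℵ₀ ≤ #L := hLc ▸ (aux_cell_spec X).1
  have hbase : ∀ x : X, ∃ b : K → Set X, (∀ k, IsOpen (b k) ∧ (b k).Nonempty) ∧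
      ∀ U, IsOpen U → x ∈ U → ∃ k, b k ⊆ U := by
    intro x
    obtain ⟨_, ℬ, h1, h2, h3⟩ := aux_pi_spec X x
    rw [← hKc] at h3
    obtain ⟨e⟩ := h3
    obtain ⟨B0, hB0, _⟩ := h2 univ isOpen_univ trivial
    have : Nonempty ℬ := ⟨⟨B0, hB0⟩⟩
    have hs : Function.Surjective (Function.invFun e) := Function.invFun_surjective e.injective
    refine ⟨fun k => ((Function.invFun e k : ℬ) : Set X), fun k => h1 _ (Function.invFun e k).2, ?_⟩
    intro U hU hx
    obtain ⟨B, hB, hBU⟩ := h2 U hU hx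
    obtain ⟨k, hk⟩ := hs ⟨B, hB⟩
    exact ⟨k, by simpa [hk] using hBU⟩
  choose b hbo hb using hbase
  have hopex : ∀ s : L → Set X, ∃ y, (closure (⋃ i, s i))ᶜ.Nonempty →
      y ∈ (closure (⋃ i, s i))ᶜ := by
    intro s
    by_cases h : (closure (⋃ i, s i))ᶜ.Nonempty
    · exact ⟨h.some, fun _ => h.some_mem⟩
    · exact ⟨x0, fun h' => absurd h' h⟩
  choose op hop using hopex
  have hd := aux_dense X hqr K L hLc x0 b hbo hb op hop
  have hcard := aux_card K L hK hL
  set T := WType (auxAr K L)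
  have hq : ∀ x k, ∃ p : T × K, b (auxEv x0 b op p.1) p.2 ⊆ b x k := by
    intro x k
    obtain ⟨_, ha, w, rfl⟩ := hd.inter_open_nonempty _ (hbo x k).1 (hbo x k).2
    obtain ⟨k', hk'⟩ := hb _ _ (hbo x k).1 ha
    exact ⟨(w, k'), hk'⟩
  choose q hq using hq
  let P : T × K → Set X := fun p => b (auxEv x0 b op p.1) p.2
  let S : X → Set (Set K) := fun x =>
    {C | ∃ U, IsOpen U ∧ x ∈ U ∧ C = {k | P (q x k) ⊆ U}}
  let Φ : X → (K → T × K) × Set (Set K) := fun x => (q x, S x)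
  have key : ∀ x y U, IsOpen U → x ∈ U → q x = q y → S x = S y → y ∈ closure U := by
    intro x y U hU hx hqe hSe
    have h1 : {k | P (q x k) ⊆ U} ∈ S y := hSe ▸ ⟨U, hU, hx, rfl⟩
    obtain ⟨O, hO, hyO, hC⟩ := h1
    rw [mem_closure_iff]
    intro G hG hyG
    obtain ⟨k, hk⟩ := hb y (O ∩ G) (hO.inter hG) ⟨hyO, hyG⟩
    have hk2 : P (q y k) ⊆ O ∩ G := (hq y k).trans hk
    have hk3 : k ∈ {k | P (q x k) ⊆ U} := by
      rw [hC]
      exact hk2.trans inter_subset_left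
    have hk4 : P (q y k) ⊆ U := by
      rw [← hqe]
      exact hk3
    obtain ⟨z, hz⟩ := (hbo (auxEv x0 b op (q y k).1) (q y k).2).2
    exact ⟨z, (hk2 hz).2, hk4 hz⟩
  have hinj : Function.Injective Φ := by
    intro x y hxy
    have h1 : q x = q y := congrArg Prod.fst hxy
    have h2 : S x = S y := congrArg Prod.snd hxy
    by_contra hne
    obtain ⟨U, V, hU, hV, hxU, hyV, hdis⟩ := t2_separation hne
    have := key x y U hU hxU h1 h2
    obtain ⟨z, hzV, hzU⟩ := mem_closure_iff.1 this V hV hyV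
    exact disjoint_left.1 hdis hzU hzV
  rw [← hKc, ← hLc]
  have h2L : (2 : Cardinal.{u}) ≤ #L := (natCast_le_aleph0 (n := 2)).trans hL
  have hL1 : #L ≤ #L ^ #K := self_le_power _ (one_le_aleph0.trans hK)
  have h2K : 2 ^ #K ≤ #L ^ #K := power_le_power_right h2L
  have hK1 : #K ≤ #L ^ #K := (cantor _).le.trans h2K
  have hM : ℵ₀ ≤ #L ^ #K := hL.trans hL1
  have hM2 : ℵ₀ ≤ (2 : Cardinal.{u}) ^ (#L ^ #K) := hM.trans (cantor _).le
  refine (mk_le_of_injective hinj).trans ?_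
  rw [mk_prod, lift_id, lift_id]
  refine mul_le_of_le hM2 ?_ ?_
  · rw [← power_def, mk_prod, lift_id, lift_id]
    calc (#T * #K) ^ #K ≤ (2 ^ (#L ^ #K)) ^ #K :=
          power_le_power_right (mul_le_of_le hM2 hcard (hK1.trans (cantor _).le))
      _ = 2 ^ ((#L ^ #K) * #K) := by rw [power_mul]
      _ ≤ _ := power_le_power_left two_ne_zero (mul_le_of_le hM le_rfl hK1)
  · rw [mk_set, mk_set]
    exact power_le_power_left two_ne_zero h2K
end

section
/- Let X be a Hausdorff topological space. Then |X| ≤ 2^{c(X)·dψc(X)·πχ(X)^{ot(X)}} (cardinal exponentiation, where the exponent is the cardinal product of c(X), dψc(X), and πχ(X)^{ot(X)}). -/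
open Set TopologicalSpace Cardinal

universe u

variable (X : Type u) [TopologicalSpace X]

theorem aux_maxDisj {X : Type u} (Q : Set (Set X)) (hQ : ∀ U ∈ Q, U.Nonempty) :
    ∃ M ⊆ Q, (M.Pairwise fun U V => U ∩ V = ∅) ∧ ∀ U ∈ Q, (U ∩ ⋃₀ M).Nonempty := by
  obtain ⟨M, hM⟩ := zorn_subset {M : Set (Set X) | M ⊆ Q ∧ M.Pairwise fun U V => U ∩ V = ∅} (by
    intro c hc hch
    refine ⟨⋃₀ c, ⟨sUnion_subset fun s hs => (hc hs).1, ?_⟩, fun s hs => subset_sUnion_of_mem hs⟩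
    exact (Set.pairwise_sUnion hch.directedOn).2 fun s hs => (hc hs).2)
  refine ⟨M, hM.prop.1, hM.prop.2, fun U hU => ?_⟩
  by_contra hne
  rw [Set.not_nonempty_iff_eq_empty] at hne
  have hd : ∀ V ∈ M, U ∩ V = ∅ := fun V hV =>
    Set.subset_empty_iff.1 (hne ▸ Set.inter_subset_inter_right U (subset_sUnion_of_mem hV))
  have hins : insert U M ⊆ M := hM.le_of_ge (y := insert U M) ⟨Set.insert_subset hU hM.prop.1, by
    refine hM.prop.2.insert fun V hV _ => ⟨hd V hV, ?_⟩
    rw [Set.inter_comm]; exact hd V hV⟩ (Set.subset_insert _ _)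
  have hUM : U ∈ M := hins (Set.mem_insert _ _)
  have h1 := hd U hUM
  rw [Set.inter_self] at h1
  exact (hQ U hU).ne_empty h1

theorem aux_enum {α K : Type u} [Nonempty K] (S : Set α) (h : #S ≤ #K) :
    ∃ e : K → Option α, ∀ a, a ∈ S ↔ ∃ k, e k = some a := by
  obtain ⟨f⟩ := (Cardinal.le_def _ _).1 h
  classical
  refine ⟨fun k => if h : ∃ a : S, f a = k then some (h.choose : α) else none, fun a => ⟨fun ha => ?_, ?_⟩⟩
  · refine ⟨f ⟨a, ha⟩, ?_⟩
    have hx : ∃ b : S, f b = f ⟨a, ha⟩ := ⟨_, rfl⟩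
    beta_reduce
    rw [dif_pos hx]
    have := f.injective hx.choose_spec
    rw [this]
  · rintro ⟨k, hk⟩
    beta_reduce at hk
    split_ifs at hk with hx
    · simp only [Option.some.injEq] at hk
      rw [← hk]; exact hx.choose.2

theorem aux_dense_s14 {X : Type u} [TopologicalSpace X] (K : Type u) [Nonempty K] (hK : ℵ₀ ≤ #K)
    (hc : ∀ 𝒰 : Set (Set X), (∀ U ∈ 𝒰, IsOpen U ∧ U.Nonempty) →
      (𝒰.Pairwise fun U V => U ∩ V = ∅) → #𝒰 ≤ #K)
    (D : Set X) (hne : D.Nonempty) (V : X → K → Set X)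
    (hV : ∀ d ∈ D, ∀ k, IsOpen (V d k) ∧ d ∈ V d k)
    (hV' : ∀ d ∈ D, ∀ y, (∀ k, y ∈ closure (V d k)) → y = d)
    (B : X → K → Set X) (hB : ∀ x k, IsOpen (B x k) ∧ (B x k).Nonempty)
    (hB' : ∀ x U, IsOpen U → x ∈ U → ∃ k, B x k ⊆ U) : #D ≤ 2 ^ #K := by
  classical
  obtain ⟨d0, hd0⟩ := hne
  let ev : Option K → X → Set X := fun o d => o.elim ∅ (B d)
  let N : (K × K → Option K) → (K × K → D) → K → Set X :=
    fun t s i => ⋃ j, ev (t (i, j)) (s (i, j))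
  let Φ : (K × K → Option K) → (K × K → D) → D := fun t s =>
    if h : ∃ d : D, ∀ i, (d : X) ∉ closure (N t s i) then h.choose else ⟨d0, hd0⟩
  have hΦ : ∀ t s, (∃ d : D, ∀ i, (d : X) ∉ closure (N t s i)) →
      ∀ i, (Φ t s : X) ∉ closure (N t s i) := by
    intro t s h
    simp only [Φ, dif_pos h]
    exact h.choose_spec
  let β : Option (K × K → Option K) → Type u := fun o => o.elim PEmpty (fun _ => K × K)
  let F : WType β → D := WType.elim D (fun p => match p with
    | ⟨none, _⟩ => ⟨d0, hd0⟩
    | ⟨some t, s⟩ => Φ t s)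
  have hF : ∀ t (s : K × K → WType β), F (WType.mk (some t) s) = Φ t (fun k => F (s k)) := 
    fun t s => rfl
  let w0 : WType β := WType.mk none (fun x => PEmpty.elim x)
  have hcard : #(WType β) ≤ 2 ^ #K := by
    apply WType.cardinalMk_le_of_le'
    have h2 : ∀ a, (2 ^ #K : Cardinal.{u}) ^ #(β a) ≤ 2 ^ #K := by
      rintro (_ | t)
      · change (2 ^ #K : Cardinal.{u}) ^ #(PEmpty.{u+1}) ≤ 2 ^ #K
        simp only [mk_pempty, power_zero]
        exact one_le_two.trans ((Cardinal.nat_lt_aleph0 2).le.trans (hK.trans (cantor _).le))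
      · change (2 ^ #K : Cardinal.{u}) ^ #(K × K) ≤ 2 ^ #K
        rw [← power_mul, mk_prod, lift_id, mul_eq_self hK, mul_eq_self hK]
    have hinf : ℵ₀ ≤ (2 : Cardinal.{u}) ^ #K := hK.trans (cantor _).le
    have hα : #(Option (K × K → Option K)) ≤ 2 ^ #K := by
      have h1 : #(Option K) = #K := by
        rw [mk_option]; exact add_one_eq hK
      have h3 : #(K × K → Option K) = 2 ^ #K := by
        rw [← power_def, h1, mk_prod, lift_id, mul_eq_self hK, power_self_eq hK]
      rw [mk_option, h3, add_one_eq hinf]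
    calc _ ≤ Cardinal.sum (fun _ : Option (K × K → Option K) => (2 ^ #K : Cardinal.{u})) :=
          Cardinal.sum_le_sum _ _ (fun a => by simpa using h2 a)
      _ = #(Option (K × K → Option K)) * 2 ^ #K := by simp
      _ ≤ 2 ^ #K * 2 ^ #K := by gcongr
      _ = 2 ^ #K := mul_eq_self hinf
  refine le_trans ?_ hcard
  apply mk_le_of_surjective (f := F)
  by_contra hsurj
  simp only [Function.Surjective, not_forall] at hsurj
  obtain ⟨p, hp⟩ := hsurj
  push Not at hp
  have key : ∀ i : K, ∃ (t : K → Option K) (s : K → WType β),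
      (p : X) ∉ closure (⋃ j, ev (t j) (F (s j))) ∧
      ∀ w, (F w : X) ∉ closure (V p i) → (F w : X) ∈ closure (⋃ j, ev (t j) (F (s j))) := by
    intro i
    obtain ⟨M, hMQ, hMd, hMm⟩ := aux_maxDisj
      {U : Set X | (∃ w k, U = B (F w) k) ∧ U ⊆ (closure (V p i))ᶜ} (by
        rintro U ⟨⟨w, k, rfl⟩, -⟩; exact (hB _ _).2)
    have hMc : #M ≤ #K := hc M (by
      intro U hU
      obtain ⟨⟨w, k, rfl⟩, -⟩ := hMQ hU
      exact hB _ _) hMd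
    obtain ⟨e, he⟩ := aux_enum M hMc
    have : ∀ j, ∃ (o : Option K) (w : WType β), ev o (F w) = (e j).elim ∅ id := by
      intro j
      rcases hj : e j with _ | U
      · exact ⟨none, w0, rfl⟩
      · obtain ⟨⟨w, k, hU⟩, -⟩ := hMQ ((he U).2 ⟨j, hj⟩)
        exact ⟨some k, w, hU.symm⟩
    choose t s hts using this
    have hun : (⋃ j, ev (t j) (F (s j))) = ⋃₀ M := by
      ext x
      simp only [mem_iUnion, hts, mem_sUnion]
      constructor
      · rintro ⟨j, hj⟩
        rcases hj' : e j with _ | U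
        · simp [hj'] at hj
        · rw [hj'] at hj
          exact ⟨U, (he U).2 ⟨j, hj'⟩, hj⟩
      · rintro ⟨U, hU, hx⟩
        obtain ⟨j, hj⟩ := (he U).1 hU
        exact ⟨j, by rw [hj]; exact hx⟩
    refine ⟨t, s, ?_, ?_⟩ <;> rw [hun]
    · intro hcl
      obtain ⟨y, hy1, U, hU, hy2⟩ := mem_closure_iff.1 hcl _ (hV p p.2 i).1 (hV p p.2 i).2
      exact (hMQ hU).2 hy2 (subset_closure hy1)
    · intro w hw
      rw [mem_closure_iff]
      intro O hO hwO
      obtain ⟨k, hk⟩ := hB' (F w) (O ∩ (closure (V p i))ᶜ)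
        (hO.inter isClosed_closure.isOpen_compl) ⟨hwO, hw⟩
      obtain ⟨y, hy1, hy2⟩ := hMm (B (F w) k) ⟨⟨w, k, rfl⟩, hk.trans inter_subset_right⟩
      exact ⟨y, (hk hy1).1, hy2⟩
  choose t s h1 h2 using key
  let t' : K × K → Option K := fun q => t q.1 q.2
  let s' : K × K → WType β := fun q => s q.1 q.2
  let w : WType β := WType.mk (some t') s'
  have hw : ∀ i, (F w : X) ∉ closure (N t' (fun k => F (s' k)) i) :=
    hΦ t' (fun k => F (s' k)) ⟨p, fun i => h1 i⟩
  apply hp w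
  apply Subtype.ext
  refine hV' p p.2 _ fun i => ?_
  by_contra hi
  exact hw i (h2 i w hi)

theorem aux_exists_fun {α K : Type u} (S : Set α) (hS : S.Nonempty) (h : #S ≤ #K) :
    ∃ e : K → α, Set.range e = S := by
  obtain ⟨f⟩ := (Cardinal.le_def _ _).1 h
  have : Nonempty S := hS.to_subtype
  refine ⟨fun k => (Function.invFun f k : S), ?_⟩
  ext a
  constructor
  · rintro ⟨k, rfl⟩; exact (Function.invFun f k).2
  · intro ha
    exact ⟨f ⟨a, ha⟩, by beta_reduce; rw [Function.leftInverse_invFun f.injective]⟩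

theorem aux_cell {X : Type u} [TopologicalSpace X] : ℵ₀ ≤ cellularity X ∧ ∀ 𝒰 : Set (Set X),
    (∀ U ∈ 𝒰, IsOpen U ∧ U.Nonempty) → (𝒰.Pairwise fun U V => U ∩ V = ∅) →
      #𝒰 ≤ cellularity X :=
  csInf_mem (s := {κ : Cardinal.{u} | ℵ₀ ≤ κ ∧ ∀ 𝒰 : Set (Set X),
    (∀ U ∈ 𝒰, IsOpen U ∧ U.Nonempty) → (𝒰.Pairwise fun U V => U ∩ V = ∅) → #𝒰 ≤ κ})
    ⟨max ℵ₀ #(Set X), le_max_left _ _, fun _ _ _ => (mk_set_le _).trans (le_max_right _ _)⟩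

theorem aux_ot {X : Type u} [TopologicalSpace X] : ℵ₀ ≤ oTightness X ∧
    ∀ (x : X) (𝒰 : Set (Set X)), (∀ U ∈ 𝒰, IsOpen U) → x ∈ closure (⋃₀ 𝒰) →
    ∃ 𝒱 ⊆ 𝒰, #𝒱 ≤ oTightness X ∧ x ∈ closure (⋃₀ 𝒱) :=
  csInf_mem (s := {κ : Cardinal.{u} | ℵ₀ ≤ κ ∧ ∀ (x : X) (𝒰 : Set (Set X)),
    (∀ U ∈ 𝒰, IsOpen U) → x ∈ closure (⋃₀ 𝒰) →
    ∃ 𝒱 ⊆ 𝒰, #𝒱 ≤ κ ∧ x ∈ closure (⋃₀ 𝒱)})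
    ⟨max ℵ₀ #(Set X), le_max_left _ _, fun _ 𝒰 _ h =>
      ⟨𝒰, subset_rfl, (mk_set_le _).trans (le_max_right _ _), h⟩⟩

theorem aux_piAt {X : Type u} [TopologicalSpace X] (x : X) : ℵ₀ ≤ piCharAt X x ∧
    ∃ ℬ : Set (Set X), (∀ B ∈ ℬ, IsOpen B ∧ B.Nonempty) ∧
    (∀ U : Set X, IsOpen U → x ∈ U → ∃ B ∈ ℬ, B ⊆ U) ∧ #ℬ ≤ piCharAt X x :=
  csInf_mem (s := {κ : Cardinal.{u} | ℵ₀ ≤ κ ∧ ∃ ℬ : Set (Set X),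
    (∀ B ∈ ℬ, IsOpen B ∧ B.Nonempty) ∧
    (∀ U : Set X, IsOpen U → x ∈ U → ∃ B ∈ ℬ, B ⊆ U) ∧ #ℬ ≤ κ})
    ⟨max ℵ₀ #(Set X), le_max_left _ _, {U | IsOpen U ∧ U.Nonempty}, fun _ h => h,
      fun U hU hx => ⟨U, ⟨hU, ⟨x, hx⟩⟩, subset_rfl⟩, (mk_set_le _).trans (le_max_right _ _)⟩

theorem aux_psiMem {X : Type u} [TopologicalSpace X] [T2Space X] (x : X) :
    max ℵ₀ #(Set X) ∈ {κ : Cardinal.{u} | ℵ₀ ≤ κ ∧ ∃ 𝒱 : Set (Set X),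
    (∀ V ∈ 𝒱, IsOpen V ∧ x ∈ V) ∧ #𝒱 ≤ κ ∧
    ({x} : Set X) = ⋂₀ 𝒱 ∧ ({x} : Set X) = ⋂ V ∈ 𝒱, closure V} := by
  have key : ∀ y, y ≠ x → ∃ V : Set X, (IsOpen V ∧ x ∈ V) ∧ y ∉ closure V := by
    intro y hy
    obtain ⟨U, W, hU, hW, hyU, hxW, hd⟩ := t2_separation hy
    exact ⟨W, ⟨hW, hxW⟩, fun h => by
      obtain ⟨z, h1, h2⟩ := mem_closure_iff.1 h U hU hyU
      exact Set.disjoint_left.1 hd h1 h2⟩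
  refine ⟨le_max_left _ _, {V | IsOpen V ∧ x ∈ V}, fun _ h => h,
    (mk_set_le _).trans (le_max_right _ _), ?_, ?_⟩
  · apply Set.Subset.antisymm
    · rintro _ rfl V hV; exact hV.2
    · intro y hy
      by_contra hne
      obtain ⟨V, hV, hn⟩ := key y hne
      exact hn (subset_closure (hy V hV))
  · apply Set.Subset.antisymm
    · rintro _ rfl
      simp only [mem_iInter]
      intro V hV; exact subset_closure hV.2
    · intro y hy
      simp only [mem_iInter] at hy
      by_contra hne
      obtain ⟨V, hV, hn⟩ := key y hne
      exact hn (hy V hV)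

theorem aux_psiAt {X : Type u} [TopologicalSpace X] [T2Space X] (x : X) :
    ℵ₀ ≤ closedPseudoCharAt X x ∧ ∃ 𝒱 : Set (Set X),
    (∀ V ∈ 𝒱, IsOpen V ∧ x ∈ V) ∧ #𝒱 ≤ closedPseudoCharAt X x ∧
    ({x} : Set X) = ⋂₀ 𝒱 ∧ ({x} : Set X) = ⋂ V ∈ 𝒱, closure V :=
  csInf_mem ⟨_, aux_psiMem x⟩

theorem aux_dpsi {X : Type u} [TopologicalSpace X] [T2Space X] : ℵ₀ ≤ densePsiC X ∧
    ∃ D : Set X, Dense D ∧ ∀ d ∈ D, closedPseudoCharAt X d ≤ densePsiC X :=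
  csInf_mem (s := {κ : Cardinal.{u} | ℵ₀ ≤ κ ∧ ∃ D : Set X, Dense D ∧
    ∀ d ∈ D, closedPseudoCharAt X d ≤ κ})
    ⟨max ℵ₀ #(Set X), le_max_left _ _, univ, dense_univ, fun d _ => csInf_le' (aux_psiMem d)⟩

theorem stmt_14 (X : Type u) [TopologicalSpace X] [T2Space X] :
    #X ≤ 2 ^ (cellularity X * densePsiC X * piChar X ^ oTightness X) := by
  classical
  rcases isEmpty_or_nonempty X with hX | hX
  · simp
  obtain ⟨hc0, hc⟩ := aux_cell (X := X)
  obtain ⟨ho0, hot⟩ := aux_ot (X := X)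
  obtain ⟨hd0, D, hD, hDψ⟩ := aux_dpsi (X := X)
  have hpi : ∀ x, piCharAt X x ≤ piChar X := fun x => le_ciSup (Cardinal.bddAbove_range _) x
  have hp0 : ℵ₀ ≤ piChar X := (aux_piAt hX.some).1.trans (hpi _)
  set c := cellularity X
  set d := densePsiC X
  set p := piChar X
  set o := oTightness X
  have hpne : p ≠ 0 := (aleph0_pos.trans_le hp0).ne'
  have hcne : c ≠ 0 := (aleph0_pos.trans_le hc0).ne'
  have hdne : d ≠ 0 := (aleph0_pos.trans_le hd0).ne'
  have hone : o ≠ 0 := (aleph0_pos.trans_le ho0).ne'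
  have hpone : p ^ o ≠ 0 := power_ne_zero _ hpne
  have hppo : p ≤ p ^ o := self_le_power _ (one_le_aleph0.trans ho0)
  set κ := c * d * p ^ o with hκ
  have hcκ : c ≤ κ := (le_mul_right hdne).trans (le_mul_right hpone)
  have hdκ : d ≤ κ := (le_mul_left hcne).trans (le_mul_right hpone)
  have hpoκ : p ^ o ≤ κ := le_mul_left (mul_ne_zero hcne hdne)
  have hpκ : p ≤ κ := hppo.trans hpoκ
  have hκ0 : ℵ₀ ≤ κ := hc0.trans hcκ
  have hinf : ℵ₀ ≤ (2 : Cardinal.{u}) ^ κ := hκ0.trans (cantor _).le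
  -- local π-bases indexed by p
  have hP : #p.out = p := mk_out p
  have hO : #o.out = o := mk_out o
  have hK : #κ.out = κ := mk_out κ
  have hBex : ∀ (L : Type u), p ≤ #L → ∀ x : X, ∃ B : L → Set X,
      (∀ k, IsOpen (B k) ∧ (B k).Nonempty) ∧
      ∀ U, IsOpen U → x ∈ U → ∃ k, B k ⊆ U := by
    intro L hL x
    obtain ⟨-, ℬ, h1, h2, h3⟩ := aux_piAt x
    obtain ⟨b, hb, -⟩ := h2 Set.univ isOpen_univ (mem_univ x)
    obtain ⟨e, he⟩ := aux_exists_fun (K := L) ℬ ⟨b, hb⟩ ((h3.trans (hpi x)).trans hL)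
    refine ⟨e, fun k => h1 _ (he ▸ mem_range_self k), fun U hU hx => ?_⟩
    obtain ⟨b, hb, hbU⟩ := h2 U hU hx
    rw [← he] at hb
    obtain ⟨k, rfl⟩ := hb
    exact ⟨k, hbU⟩
  have hDcard : #D ≤ 2 ^ κ := by
    choose B hB hB' using hBex κ.out (hpκ.trans hK.ge)
    have hVex : ∀ x : X, ∃ V : κ.out → Set X, x ∈ D →
        (∀ k, IsOpen (V k) ∧ x ∈ V k) ∧ ∀ y, (∀ k, y ∈ closure (V k)) → y = x := by
      intro x
      by_cases hx : x ∈ D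
      swap
      · exact ⟨fun _ => ∅, fun h => absurd h hx⟩
      obtain ⟨-, 𝒱, h1, h2, h3, h4⟩ := aux_psiAt x
      have h2' : #(insert Set.univ 𝒱 : Set (Set X)) ≤ #κ.out := by
        refine mk_insert_le.trans ?_
        rw [hK]
        exact add_le_of_le hκ0 ((h2.trans (hDψ x hx)).trans hdκ)
          (one_le_aleph0.trans hκ0)
      obtain ⟨e, he⟩ := aux_exists_fun (K := κ.out) (insert Set.univ 𝒱) ⟨Set.univ, mem_insert _ _⟩ h2'
      refine ⟨e, fun _ => ⟨fun k => ?_, fun y hy => ?_⟩⟩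
      · have : e k ∈ insert Set.univ 𝒱 := he ▸ mem_range_self k
        rcases this with h | h
        · rw [h]; exact ⟨isOpen_univ, mem_univ _⟩
        · exact h1 _ h
      · have : y ∈ ({x} : Set X) := by
          rw [h4]
          simp only [mem_iInter]
          intro V hV
          have : V ∈ range e := he ▸ mem_insert_of_mem _ hV
          obtain ⟨k, rfl⟩ := this
          exact hy k
        exact this
    choose V hV using hVex
    have hKne : Nonempty κ.out := by
      rw [← mk_ne_zero_iff, hK]; exact (aleph0_pos.trans_le hκ0).ne'
    have := aux_dense_s14 κ.out (hκ0.trans hK.ge) (fun 𝒰 h1 h2 => ((hc 𝒰 h1 h2).trans hcκ).trans hK.ge)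
      D hD.nonempty V (fun d hd => (hV d hd).1) (fun d hd => (hV d hd).2) B hB hB'
    rwa [hK] at this
  choose B hB hB' using hBex p.out hP.ge
  -- π-base
  let Pb := D × p.out
  have hPb : #Pb ≤ 2 ^ κ := by
    rw [mk_prod, lift_id, lift_id, hP]
    exact mul_le_of_le hinf hDcard (hpκ.trans (cantor _).le)
  have hfex : ∀ (x : X) (k : p.out), ∃ q : Pb, B q.1 q.2 ⊆ B x k := by
    intro x k
    obtain ⟨y, hy1, hy2⟩ := hD.inter_open_nonempty _ (hB x k).1 (hB x k).2
    obtain ⟨j, hj⟩ := hB' y _ (hB x k).1 hy1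
    exact ⟨(⟨y, hy2⟩, j), hj⟩
  choose f hf using hfex
  let G : Pb → Set X := fun q => B q.1 q.2
  let code : X → (p.out → Pb) × Set (o.out → p.out) := fun x =>
    (f x, {g | x ∈ closure (⋃ k, G (f x (g k)))})
  have hinj : Function.Injective code := by
    intro x y hxy
    by_contra hne
    obtain ⟨h1, h2⟩ := Prod.mk.inj hxy
    obtain ⟨U, W, hU, hW, hxU, hyW, hd⟩ := t2_separation hne
    obtain ⟨𝒱, hsub, hcard, hx⟩ := hot x {S | (∃ k, S = G (f x k)) ∧ S ⊆ U} (by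
      rintro S ⟨⟨k, rfl⟩, -⟩; exact (hB _ _).1) (by
      rw [mem_closure_iff]
      intro O hO hxO
      obtain ⟨k, hk⟩ := hB' x (O ∩ U) (hO.inter hU) ⟨hxO, hxU⟩
      have hk2 : G (f x k) ⊆ O ∩ U := (hf x k).trans hk
      obtain ⟨z, hz⟩ := (hB (f x k).1 (f x k).2).2
      exact ⟨z, (hk2 hz).1, G (f x k), ⟨⟨k, rfl⟩, hk2.trans inter_subset_right⟩, hz⟩)
    have hVne : 𝒱.Nonempty := by
      obtain ⟨z, -, S, hS, -⟩ := mem_closure_iff.1 hx Set.univ isOpen_univ (mem_univ x)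
      exact ⟨S, hS⟩
    obtain ⟨e, he⟩ := aux_exists_fun (K := o.out) 𝒱 hVne (hcard.trans hO.ge)
    have hek : ∀ k, e k ∈ 𝒱 := fun k => he ▸ mem_range_self k
    choose g hg using fun k => (hsub (hek k)).1
    have hun : (⋃ k, G (f x (g k))) = ⋃₀ 𝒱 := by
      rw [← he, sUnion_range]
      exact iUnion_congr fun k => (hg k).symm
    have hgx : g ∈ {g | x ∈ closure (⋃ k, G (f x (g k)))} := by
      change x ∈ closure (⋃ k, G (f x (g k)))
      rw [hun]; exact hx
    rw [h2] at hgx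
    change y ∈ closure (⋃ k, G (f y (g k))) at hgx
    rw [← h1, hun] at hgx
    obtain ⟨z, hz1, S, hS, hz2⟩ := mem_closure_iff.1 hgx W hW hyW
    exact Set.disjoint_left.1 hd ((hsub hS).2 hz2) hz1
  refine (mk_le_of_injective hinj).trans ?_
  rw [mk_prod, lift_id, lift_id, mk_set, ← power_def, ← power_def, hP, hO]
  refine mul_le_of_le hinf ?_ (power_le_power_left two_ne_zero hpoκ)
  calc #Pb ^ p ≤ (2 ^ κ) ^ κ :=
        (power_le_power_right hPb).trans (power_le_power_left (power_ne_zero _ two_ne_zero) hpκ)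
    _ = 2 ^ κ := by rw [← power_mul, mul_eq_self hκ0]
end
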